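/- Let n ≥ 1, let r > 0 be a real number, and let P be a nonzero real symmetric n×n matrix. Then there exists a complex number λ with Re λ > 0 such that det(λ²·(1 : Matrix) + r·(1 : Matrix).map ℂ + Complex.I • P.map ℂ) = 0. In other words, a stable potential system with all natural frequencies equal (stiffness matrix r·I, r > 0) becomes unstable under the addition of any nonzero nonconservative positional force iP, even without damping. -/

import Mathlib

open Matrix

/-- A complex number that is not real has a square root in the open right half-plane. -/
theorem exists_sq_eq_of_im_ne_zero {z : ℂ} (hz : z.im ≠ 0) :
    ∃ w : ℂ, 0 < w.re ∧ w ^ 2 = z := by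
  obtain ⟨w, rfl⟩ := IsAlgClosed.exists_pow_nat_eq z two_pos
  have hw : w.re ≠ 0 := fun h => hz (by simp [sq, h])
  rcases hw.lt_or_gt with h | h
  · exact ⟨-w, by simpa using h, by ring⟩
  · exact ⟨w, h, rfl⟩

/-- A nonzero real symmetric matrix has an eigenvector with a nonzero eigenvalue. -/
theorem Matrix.IsSymm.exists_mulVec_eq_smul_of_ne_zero {ι : Type*} [Fintype ι] [DecidableEq ι]
    {P : Matrix ι ι ℝ} (hPsymm : P.IsSymm) (hP : P ≠ 0) :
    ∃ (μ : ℝ) (v : ι → ℝ), μ ≠ 0 ∧ v ≠ 0 ∧ P *ᵥ v = μ • v := by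
  have hH : P.IsHermitian := by
    rwa [Matrix.IsHermitian, conjTranspose_eq_transpose_of_trivial]
  obtain ⟨i, hi⟩ := Function.ne_iff.mp (mt hH.eigenvalues_eq_zero_iff.mp hP)
  refine ⟨hH.eigenvalues i, hH.eigenvectorBasis i, hi, fun h => ?_, hH.mulVec_eigenvectorBasis i⟩
  exact hH.eigenvectorBasis.orthonormal.ne_zero i (by ext j; exact congrFun h j)

/-- **Unstable levitation I** (equal natural frequencies instance).
A stable potential system with stiffness matrix `r • I` (`r > 0`) becomes
unstable under the addition of any nonzero nonconservative positional force
`iP`, even without damping. -/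
theorem unstable_levitation_equal_frequencies (n : ℕ) (hn : 1 ≤ n)
    (r : ℝ) (hr : 0 < r)
    (P : Matrix (Fin n) (Fin n) ℝ) (hPsymm : P.IsSymm) (hP : P ≠ 0) :
    ∃ lam : ℂ, 0 < lam.re ∧
      (lam ^ 2 • (1 : Matrix (Fin n) (Fin n) ℂ)
        + (r • (1 : Matrix (Fin n) (Fin n) ℝ)).map Complex.ofReal
        + Complex.I • P.map Complex.ofReal).det = 0 := by
  obtain ⟨μ, v, hμ, hv, hPv⟩ := hPsymm.exists_mulVec_eq_smul_of_ne_zero hP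
  obtain ⟨lam, hre, hlam⟩ :=
    exists_sq_eq_of_im_ne_zero (z := -(r + Complex.I * μ)) (by simpa using hμ)
  refine ⟨lam, hre, exists_mulVec_eq_zero_iff.mp ⟨fun i => (v i : ℂ), fun h => hv ?_, ?_⟩⟩
  · ext i
    simpa using congrFun h i
  have hP' : P.map Complex.ofReal *ᵥ (fun i => (v i : ℂ)) = (μ : ℂ) • fun i => (v i : ℂ) := by
    ext i
    have := congrArg Complex.ofReal (congrFun hPv i)
    simpa [mulVec, dotProduct] using this
  have hr' : (r • (1 : Matrix (Fin n) (Fin n) ℝ)).map Complex.ofReal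
      = (r : ℂ) • (1 : Matrix (Fin n) (Fin n) ℂ) := by
    ext i j
    by_cases h : i = j <;> simp [h, one_apply]
  rw [hr', add_mulVec, add_mulVec, smul_mulVec, smul_mulVec, smul_mulVec, hP', one_mulVec, hlam]
  ext i
  simp
  ring
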